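/- arXiv:2312.01057 — 3 statements merged into one kernel-verified Lean document; each statement's English description precedes it below -/
import Mathlib

section
/- (Proposition 1, RLPO failure.) Assume the dichotomy data model with query size k ≥ 3, ζ = P_π̄(M1) ∈ (0,1), p*(1) ∈ (0,1), and p*(1) < F(ζ) where F(ζ) = (ζ - ζ^k)/(1 - ζ^k - (1-ζ)^k). Let ψ̂ be a minimizer of L_reward(r_ψ) over ψ ∈ ℝ² if a minimizer exists and ψ̂ = 0 otherwise, and let θ̂ minimize L_policy(π_θ | r_ψ̂) over θ ∈ ℝ². Then as the dataset size n → ∞, P_{π_θ̂}(M1) → 0 in probability and P_{π_θ̂}(M2) → 1 in probability. -/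
open MeasureTheory Filter Finset Real

/-- Number of category-1 messages in a query, given the vector of category
indicators of its `k` messages (`true` = category 1). -/
def catCount {k : ℕ} (v : Fin k → Bool) : ℕ := (Finset.univ.filter fun j => v j = true).card

/-- Probability that the chosen message is of category 1, given the category
pattern `v` of the query: the annotator's type is 1 with probability `p1`; the
choice is uniform on the messages of the annotator's category if present, and
uniform on the whole query otherwise. -/
noncomputable def chooseCat1Prob {k : ℕ} (p1 : ℝ) (v : Fin k → Bool) : ℝ :=
  if ∀ j, v j = true then 1 else if ∃ j, v j = true then p1 else 0

/-- Probability of a single datum pattern `(v, c)` in the dichotomy data model: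
`v j` is the category indicator of the `j`-th message of the query (each message
is of category 1 independently with probability `ζ = P_π̄(M1)`, the base policy
being uniform within each category), and `c` is the category of the chosen
message.  Since the reward and policy architectures depend on a message only
through its category, this pattern carries all the relevant information. -/
noncomputable def datumProb {k : ℕ} (ζ p1 : ℝ) (d : (Fin k → Bool) × Bool) : ℝ :=
  (∏ j, if d.1 j then ζ else 1 - ζ) *
    (if d.2 then chooseCat1Prob p1 d.1 else 1 - chooseCat1Prob p1 d.1)

/-- Total probability `P_{π_θ}(M1)` assigned by the policy `π_θ` to the `m1`
category-1 messages, for the two-parameter policy architecture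
`P_{π_θ}(x) = e^{θ_z}/(m1 e^{θ1} + m2 e^{θ2})` for `x` of category `z`. -/
noncomputable def polM1 (m1 m2 : ℕ) (θ : ℝ × ℝ) : ℝ :=
  m1 * exp θ.1 / (m1 * exp θ.1 + m2 * exp θ.2)

/-- Total probability `P_{π_θ}(M2)` assigned by the policy `π_θ` to the `m2`
category-2 messages. -/
noncomputable def polM2 (m1 m2 : ℕ) (θ : ℝ × ℝ) : ℝ :=
  m2 * exp θ.2 / (m1 * exp θ.1 + m2 * exp θ.2)

/-- The reward loss `L_reward(r_ψ) = -Σ_{(Y,y)∈D} ln(e^{r_ψ(y)} / Σ_{y'∈Y} e^{r_ψ(y')})`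
for the two-parameter reward architecture `r_ψ(x) = ψ_z` for `x` of category `z`,
written in terms of the dataset's category pattern. -/
noncomputable def rewardLoss {k n : ℕ} (d : Fin n → (Fin k → Bool) × Bool) (ψ : ℝ × ℝ) : ℝ :=
  -∑ i, ((if (d i).2 then ψ.1 else ψ.2) -
    log ((catCount (d i).1 : ℝ) * exp ψ.1 + ((k : ℝ) - (catCount (d i).1 : ℝ)) * exp ψ.2))

/-- The policy loss `L_policy(π_θ | r_ψ) = -n Σ_x P_{π_θ}(x) r_ψ(x) + β KL(P_{π_θ} ‖ P_π̄)`
for the two-parameter architectures, with base distribution uniform within each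
category and `P_π̄(M1) = ζ`. -/
noncomputable def policyLoss (m1 m2 : ℕ) (ζ β : ℝ) (n : ℕ) (ψ θ : ℝ × ℝ) : ℝ :=
  -(n : ℝ) * (polM1 m1 m2 θ * ψ.1 + polM2 m1 m2 θ * ψ.2) +
    β * (polM1 m1 m2 θ * log (polM1 m1 m2 θ / ζ) +
      polM2 m1 m2 θ * log (polM2 m1 m2 θ / (1 - ζ)))

lemma exists_neg_lt_of_hasDerivAt_pos {f : ℝ → ℝ} {f' : ℝ} (h : HasDerivAt f f' 0)
    (hf' : 0 < f') : ∃ t < 0, f t < f 0 := by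
  have h1 := (hasDerivAt_iff_tendsto_slope.1 h).mono_left
    (nhdsWithin_mono (0 : ℝ) (fun x (hx : x ∈ Set.Iio (0 : ℝ)) => ne_of_lt hx))
  obtain ⟨t, ht, ht0⟩ := ((h1.eventually_const_lt hf').and self_mem_nhdsWithin).exists
  refine ⟨t, ht0, ?_⟩
  rw [slope_def_field, sub_zero] at ht
  by_contra! hc
  exact absurd (div_nonpos_of_nonneg_of_nonpos (sub_nonneg.2 hc) (le_of_lt ht0)) (not_le.2 ht)

/-- Chernoff-type law of large numbers for i.i.d. data on a finite type. -/
lemma tendsto_measure_sum_nonpos {α Ω : Type*} [Fintype α] [MeasurableSpace Ω] (μ : Measure Ω)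
    (w g : α → ℝ) (hw : ∀ a, 0 ≤ w a) (hw1 : ∑ a, w a = 1) (hg : 0 < ∑ a, w a * g a)
    (D : (n : ℕ) → Fin n → Ω → α)
    (hiid : ∀ n (dd : Fin n → α),
      μ {ω | ∀ i, D n i ω = dd i} = ENNReal.ofReal (∏ i, w (dd i))) :
    Tendsto (fun n => μ {ω | ∑ i, g (D n i ω) ≤ 0}) atTop (nhds 0) := by
  classical
  have hder : HasDerivAt (fun t => ∑ a, w a * exp (t * g a)) (∑ a, w a * g a) 0 := by
    refine HasDerivAt.fun_sum fun a _ => ?_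
    simpa using (((hasDerivAt_id (0 : ℝ)).mul_const (g a)).exp).const_mul (w a)
  obtain ⟨t, ht, hM⟩ := exists_neg_lt_of_hasDerivAt_pos hder hg
  simp only [zero_mul, exp_zero, mul_one, hw1] at hM
  set M := ∑ a, w a * exp (t * g a) with hMdef
  have hM0 : 0 ≤ M := Finset.sum_nonneg fun a _ => mul_nonneg (hw a) (exp_pos _).le
  have hlim : Tendsto (fun n : ℕ => ENNReal.ofReal (M ^ n)) atTop (nhds 0) := by
    simpa using ENNReal.tendsto_ofReal (tendsto_pow_atTop_nhds_zero_of_lt_one hM0 hM)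
  refine tendsto_of_tendsto_of_tendsto_of_le_of_le tendsto_const_nhds hlim
    (fun _ => zero_le) fun n => ?_
  let S : Finset (Fin n → α) := Finset.univ.filter fun dd => ∑ i, g (dd i) ≤ 0
  have hsub : {ω | ∑ i, g (D n i ω) ≤ 0} ⊆ ⋃ dd ∈ S, {ω | ∀ i, D n i ω = dd i} := by
    intro ω hω
    simp only [Set.mem_iUnion]
    exact ⟨fun i => D n i ω, Finset.mem_filter.2 ⟨Finset.mem_univ _, hω⟩, fun i => rfl⟩
  calc μ {ω | ∑ i, g (D n i ω) ≤ 0}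
      ≤ ∑ dd ∈ S, μ {ω | ∀ i, D n i ω = dd i} :=
        (measure_mono hsub).trans (measure_biUnion_finset_le _ _)
    _ = ENNReal.ofReal (∑ dd ∈ S, ∏ i, w (dd i)) := by
        rw [ENNReal.ofReal_sum_of_nonneg fun dd _ => Finset.prod_nonneg fun i _ => hw _]
        exact Finset.sum_congr rfl fun dd _ => hiid n dd
    _ ≤ ENNReal.ofReal (M ^ n) := by
        refine ENNReal.ofReal_le_ofReal ?_
        rw [hMdef, Fintype.sum_pow]
        refine (Finset.sum_le_sum (g := fun dd => ∏ i, w (dd i) * exp (t * g (dd i)))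
          fun dd hdd => ?_).trans (Finset.sum_le_univ_sum_of_nonneg fun dd =>
            Finset.prod_nonneg fun i _ => mul_nonneg (hw _) (exp_pos _).le)
        rw [Finset.prod_mul_distrib, ← exp_sum, ← Finset.mul_sum]
        refine le_mul_of_one_le_right (Finset.prod_nonneg fun i _ => hw _) (one_le_exp ?_)
        exact mul_nonneg_of_nonpos_of_nonpos ht.le (Finset.mem_filter.1 hdd).2

/-- A function with a supporting line at every point, which takes a smaller value at `b` than at
`a < b` and at `c > b`, attains its minimum, and only to the left of `c`. -/
lemma exists_minimizer_of_support {f : ℝ → ℝ} (hf : Continuous f)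
    (hs : ∀ y, ∃ s, ∀ x, f y + s * (x - y) ≤ f x) {a b c : ℝ} (hab : a < b) (hbc : b < c)
    (ha : f b < f a) (hc : f b < f c) :
    (∃ x, ∀ y, f x ≤ f y) ∧ ∀ x, (∀ y, f x ≤ f y) → x < c := by
  have hr : ∀ x, c ≤ x → f b < f x := by
    intro x hx
    obtain ⟨s, hs⟩ := hs c
    have h1 := hs b
    have h2 := hs x
    have hs0 : 0 < s := by by_contra! h; nlinarith
    nlinarith
  have hl : ∀ x, x ≤ a → f b < f x := by
    intro x hx
    obtain ⟨s, hs⟩ := hs a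
    have h1 := hs b
    have h2 := hs x
    have hs0 : s < 0 := by by_contra! h; nlinarith
    nlinarith
  refine ⟨?_, fun x hx => ?_⟩
  · obtain ⟨x, -, hx⟩ := isCompact_Icc.exists_isMinOn (s := Set.Icc a c)
      ⟨b, hab.le, hbc.le⟩ hf.continuousOn
    refine ⟨x, fun y => ?_⟩
    have hb : f x ≤ f b := hx ⟨hab.le, hbc.le⟩
    rcases le_total y a with h | h
    · exact hb.trans (hl y h).le
    rcases le_total c y with h' | h'
    · exact hb.trans (hr y h').le
    · exact hx ⟨h, h'⟩
  · by_contra! h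
    exact absurd (hx b) (not_le.2 (hr x h))

/-- The reward loss of a single datum as a function of the reward gap `ψ1 - ψ2`. -/
noncomputable def datumLoss {k : ℕ} (d : (Fin k → Bool) × Bool) (x : ℝ) : ℝ :=
  log ((catCount d.1 : ℝ) * exp x + ((k : ℝ) - (catCount d.1 : ℝ))) - if d.2 then x else 0

lemma catCount_le {k : ℕ} (v : Fin k → Bool) : (catCount v : ℝ) ≤ k := by
  have h : catCount v ≤ Fintype.card (Fin k) := Finset.card_filter_le _ _
  rw [Fintype.card_fin] at h
  exact_mod_cast h

lemma partition_pos {k : ℕ} (hk : 0 < k) (v : Fin k → Bool) (x : ℝ) :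
    0 < (catCount v : ℝ) * exp x + ((k : ℝ) - (catCount v : ℝ)) := by
  have h := catCount_le v
  have hk' : (0 : ℝ) < k := by exact_mod_cast hk
  rcases h.lt_or_eq with h | h
  · have := mul_nonneg (Nat.cast_nonneg (α := ℝ) (catCount v)) (exp_pos x).le
    linarith
  · rw [h]
    have := mul_pos hk' (exp_pos x)
    linarith

lemma rewardLoss_eq {k n : ℕ} (hk : 0 < k) (d : Fin n → (Fin k → Bool) × Bool) (ψ : ℝ × ℝ) :
    rewardLoss d ψ = ∑ i, datumLoss (d i) (ψ.1 - ψ.2) := by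
  rw [rewardLoss, ← Finset.sum_neg_distrib]
  refine Finset.sum_congr rfl fun i _ => ?_
  have h : (catCount (d i).1 : ℝ) * exp ψ.1 + ((k : ℝ) - (catCount (d i).1 : ℝ)) * exp ψ.2 =
      exp ψ.2 * ((catCount (d i).1 : ℝ) * exp (ψ.1 - ψ.2) + ((k : ℝ) - (catCount (d i).1 : ℝ))) := by
    rw [exp_sub]
    field_simp
  rw [h, log_mul (exp_pos _).ne' (partition_pos hk _ _).ne', log_exp, datumLoss]
  split_ifs <;> ring

lemma datumLoss_support {k : ℕ} (hk : 0 < k) (d : (Fin k → Bool) × Bool) (y : ℝ) :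
    ∃ s, ∀ x, datumLoss d y + s * (x - y) ≤ datumLoss d x := by
  have hZ := partition_pos hk d.1 y
  set j : ℝ := (catCount d.1 : ℝ) with hj
  set Z : ℝ := j * exp y + ((k : ℝ) - j) with hZdef
  have hj0 : 0 ≤ j := Nat.cast_nonneg _
  have hjk : j ≤ k := catCount_le d.1
  refine ⟨j * exp y / Z - (if d.2 then 1 else 0), fun x => ?_⟩
  have hp : 0 ≤ j * exp y / Z := div_nonneg (mul_nonneg hj0 (exp_pos _).le) hZ.le
  have hq : 0 ≤ ((k : ℝ) - j) / Z := div_nonneg (sub_nonneg.2 hjk) hZ.le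
  have hpq : j * exp y / Z + ((k : ℝ) - j) / Z = 1 := by
    rw [← add_div]
    exact div_self hZ.ne'
  have hlog := strictConcaveOn_log_Ioi.concaveOn.2 (Set.mem_Ioi.2 (exp_pos (x - y)))
    (Set.mem_Ioi.2 one_pos) hp hq hpq
  simp only [smul_eq_mul, log_exp, log_one, mul_zero, add_zero, mul_one] at hlog
  have hmul : j * exp x + ((k : ℝ) - j) =
      Z * (j * exp y / Z * exp (x - y) + ((k : ℝ) - j) / Z) := by
    rw [exp_sub]
    field_simp
  have hpos : 0 < j * exp y / Z * exp (x - y) + ((k : ℝ) - j) / Z :=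
    pos_of_mul_pos_right (hmul ▸ partition_pos hk d.1 x) hZ.le
  simp only [datumLoss]
  rw [← hj, hmul, log_mul hZ.ne' hpos.ne', ← hZdef]
  split_ifs <;> nlinarith

lemma hasDerivAt_datumLoss_zero {k : ℕ} (hk : 0 < k) (d : (Fin k → Bool) × Bool) :
    HasDerivAt (datumLoss d) ((catCount d.1 : ℝ) / k - if d.2 then 1 else 0) 0 := by
  have h0 := partition_pos hk d.1 0
  have h1 := ((((hasDerivAt_exp 0).const_mul (catCount d.1 : ℝ)).add_const
    ((k : ℝ) - (catCount d.1 : ℝ))).log h0.ne').fun_sub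
    (f := fun x => log ((catCount d.1 : ℝ) * exp x + ((k : ℝ) - (catCount d.1 : ℝ))))
    (g := fun x => if d.2 then x else 0) (g' := if d.2 then 1 else 0)
    (by split_ifs; exacts [hasDerivAt_id' _, hasDerivAt_const _ _])
  convert! h1 using 1
  simp

lemma continuous_datumLoss {k : ℕ} (hk : 0 < k) (d : (Fin k → Bool) × Bool) :
    Continuous (datumLoss d) := by
  unfold datumLoss
  refine Continuous.sub (Continuous.log (by fun_prop) fun x => (partition_pos hk d.1 x).ne') ?_
  split_ifs <;> fun_prop

lemma polM1_add_polM2 {m1 m2 : ℕ} (hm1 : 1 ≤ m1) (θ : ℝ × ℝ) :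
    polM1 m1 m2 θ + polM2 m1 m2 θ = 1 := by
  have : (0 : ℝ) < m1 := by exact_mod_cast hm1
  rw [polM1, polM2, ← add_div]
  exact div_self (by positivity)

lemma polM1_pos {m1 m2 : ℕ} (hm1 : 1 ≤ m1) (θ : ℝ × ℝ) : 0 < polM1 m1 m2 θ := by
  have : (0 : ℝ) < m1 := by exact_mod_cast hm1
  rw [polM1]
  positivity

lemma polM2_pos {m1 m2 : ℕ} (hm2 : 1 ≤ m2) (θ : ℝ × ℝ) : 0 < polM2 m1 m2 θ := by
  have : (0 : ℝ) < m2 := by exact_mod_cast hm2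
  rw [polM2]
  positivity

lemma exists_polM1_eq {m1 m2 : ℕ} (hm1 : 1 ≤ m1) (hm2 : 1 ≤ m2) {q : ℝ} (h0 : 0 < q)
    (h1 : q < 1) : ∃ θ, polM1 m1 m2 θ = q := by
  have : (0 : ℝ) < m1 := by exact_mod_cast hm1
  have : (0 : ℝ) < m2 := by exact_mod_cast hm2
  have h1' : 0 < 1 - q := sub_pos.2 h1
  refine ⟨(log (q / m1), log ((1 - q) / m2)), ?_⟩
  rw [polM1, exp_log (by positivity), exp_log (by positivity)]
  field_simp
  ring

lemma sub_le_mul_log_div {p z : ℝ} (hp : 0 < p) (hz : 0 < z) : p - z ≤ p * log (p / z) := by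
  have h := mul_le_mul_of_nonneg_left (one_sub_inv_le_log_of_pos (div_pos hp hz)) hp.le
  have : p * (1 - (p / z)⁻¹) = p - z := by
    field_simp
  linarith

/-- A minimizer of the policy loss gives small mass to `M1` when the total reward gap is large
in favour of `M2`. -/
lemma polM1_mul_le_of_minimizer {m1 m2 : ℕ} (hm1 : 1 ≤ m1) (hm2 : 1 ≤ m2) {ζ β : ℝ}
    (hζ : ζ ∈ Set.Ioo (0 : ℝ) 1) (hβ : 0 < β) (n : ℕ) (ψ θ : ℝ × ℝ)
    (hθ : ∀ θ', policyLoss m1 m2 ζ β n ψ θ ≤ policyLoss m1 m2 ζ β n ψ θ') :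
    n * (ψ.2 - ψ.1) * polM1 m1 m2 θ ≤ -(β * log (1 - ζ)) := by
  obtain ⟨hζ0, hζ1⟩ := hζ
  have hp := polM1_pos (m2 := m2) hm1 θ
  have hp2 := polM2_pos (m1 := m1) hm2 θ
  have hpp : polM2 m1 m2 θ = 1 - polM1 m1 m2 θ := by linarith [polM1_add_polM2 (m2 := m2) hm1 θ]
  set p := polM1 m1 m2 θ with hpdef
  have hKL : 0 ≤ p * log (p / ζ) + (1 - p) * log ((1 - p) / (1 - ζ)) := by
    have h1 := sub_le_mul_log_div hp hζ0
    have h2 := sub_le_mul_log_div (p := 1 - p) (z := 1 - ζ) (by linarith) (by linarith)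
    linarith
  have key : ∀ q ∈ Set.Ioo 0 ζ,
      n * (ψ.2 - ψ.1) * p ≤ n * (ψ.2 - ψ.1) * q - β * log (1 - ζ) := by
    rintro q ⟨hq0, hqζ⟩
    obtain ⟨θ', hθ'⟩ := exists_polM1_eq hm1 hm2 hq0 (hqζ.trans hζ1)
    have hq2 : polM2 m1 m2 θ' = 1 - q := by linarith [polM1_add_polM2 (m2 := m2) hm1 θ']
    have h := hθ θ'
    rw [policyLoss, policyLoss, hθ', hq2, hpp, ← hpdef] at h
    have h1 : q * log (q / ζ) ≤ 0 :=
      mul_nonpos_of_nonneg_of_nonpos hq0.le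
        (log_nonpos (by positivity) ((div_le_one hζ0).2 hqζ.le))
    have h2 : (1 - q) * log ((1 - q) / (1 - ζ)) ≤ - log (1 - ζ) := by
      rw [log_div (by linarith) (by linarith)]
      have := log_nonpos (x := 1 - q) (by linarith) (by linarith)
      have := log_nonpos (x := 1 - ζ) (by linarith) (by linarith)
      nlinarith
    nlinarith
  have hlim : Tendsto (fun q => n * (ψ.2 - ψ.1) * q - β * log (1 - ζ)) (nhdsWithin 0 (Set.Ioi 0))
      (nhds (n * (ψ.2 - ψ.1) * 0 - β * log (1 - ζ))) :=
    (Continuous.tendsto (by fun_prop) 0).mono_left nhdsWithin_le_nhds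
  rw [mul_zero, zero_sub] at hlim
  refine ge_of_tendsto hlim ?_
  filter_upwards [Ioo_mem_nhdsGT hζ0] with q hq using key q hq

lemma chooseCat1Prob_mem {k : ℕ} {p1 : ℝ} (hp1 : p1 ∈ Set.Ioo (0 : ℝ) 1) (v : Fin k → Bool) :
    chooseCat1Prob p1 v ∈ Set.Icc (0 : ℝ) 1 := by
  unfold chooseCat1Prob
  split_ifs
  · simp
  · exact ⟨hp1.1.le, hp1.2.le⟩
  · simp

lemma datumProb_nonneg {k : ℕ} {ζ p1 : ℝ} (hζ : ζ ∈ Set.Ioo (0 : ℝ) 1)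
    (hp1 : p1 ∈ Set.Ioo (0 : ℝ) 1) (d : (Fin k → Bool) × Bool) : 0 ≤ datumProb ζ p1 d := by
  have h := chooseCat1Prob_mem hp1 d.1
  refine mul_nonneg (Finset.prod_nonneg fun j _ => ?_) ?_
  · split_ifs
    exacts [hζ.1.le, sub_nonneg.2 hζ.2.le]
  · split_ifs
    exacts [h.1, sub_nonneg.2 h.2]

lemma sum_patternProb (k : ℕ) (ζ : ℝ) :
    ∑ v : Fin k → Bool, ∏ j, (if v j then ζ else 1 - ζ) = 1 := by
  have h := (Fintype.sum_pow (fun b : Bool => if b then ζ else 1 - ζ) k).symm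
  simpa using h

lemma sum_patternProb_mul_catCount (k : ℕ) (ζ : ℝ) :
    ∑ v : Fin k → Bool, (∏ j, (if v j then ζ else 1 - ζ)) * (catCount v : ℝ) = k * ζ := by
  have hcount : ∀ v : Fin k → Bool, (catCount v : ℝ) = ∑ i, if v i then (1 : ℝ) else 0 := by
    intro v
    simp [catCount]
  simp only [hcount, Finset.mul_sum]
  rw [Finset.sum_comm]
  have hone : ∀ i : Fin k, ∑ v : Fin k → Bool,
      (∏ j, (if v j then ζ else 1 - ζ)) * (if v i then (1 : ℝ) else 0) = ζ := by
    intro i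
    have h := Finset.sum_prod_piFinset (ι := Fin k) (Finset.univ : Finset Bool)
      (fun j b => (if b then ζ else 1 - ζ) * if j = i then (if b then (1 : ℝ) else 0) else 1)
    rw [Fintype.piFinset_univ] at h
    have h2 : ∀ v : Fin k → Bool, (∏ j, (if v j then ζ else 1 - ζ)) * (if v i then (1 : ℝ) else 0) =
        ∏ j, ((if v j then ζ else 1 - ζ) * if j = i then (if v j then (1 : ℝ) else 0) else 1) := by
      intro v
      rw [Finset.prod_mul_distrib, Finset.prod_ite_eq']
      simp
    simp only [h2]
    rw [h, ← Finset.prod_erase_mul _ _ (Finset.mem_univ i), Finset.prod_eq_one]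
    · simp
    · intro j hj
      simp [Finset.ne_of_mem_erase hj]
  rw [Finset.sum_congr rfl fun i _ => hone i]
  simp

lemma sum_patternProb_mul_chooseCat1Prob {k : ℕ} (hk : 0 < k) (ζ p1 : ℝ) :
    ∑ v : Fin k → Bool, (∏ j, (if v j then ζ else 1 - ζ)) * chooseCat1Prob p1 v =
      ζ ^ k + p1 * (1 - ζ ^ k - (1 - ζ) ^ k) := by
  have hdec : ∀ v : Fin k → Bool, chooseCat1Prob p1 v =
      p1 + (if v = (fun _ => true) then 1 - p1 else 0) + (if v = (fun _ => false) then - p1 else 0) := by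
    intro v
    have h1 : (v = fun _ => true) ↔ ∀ j, v j = true := funext_iff
    have h2 : (v = fun _ => false) ↔ ¬ ∃ j, v j = true := by simp [funext_iff]
    by_cases ht : ∀ j, v j = true
    · have he : ∃ j, v j = true := ⟨⟨0, hk⟩, ht _⟩
      simp only [chooseCat1Prob, h1, h2, if_pos ht, if_neg (not_not.2 he)]
      ring
    · by_cases he : ∃ j, v j = true
      · simp only [chooseCat1Prob, h1, h2, if_neg ht, if_pos he, if_neg (not_not.2 he)]
        ring
      · simp only [chooseCat1Prob, h1, h2, if_neg ht, if_neg he, if_pos he]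
        ring
  simp only [hdec, mul_add, Finset.sum_add_distrib, ← Finset.sum_mul, sum_patternProb, mul_ite,
    mul_zero, Finset.sum_ite_eq', Finset.mem_univ, if_true]
  simp
  ring

lemma sum_datumProb_mul {k : ℕ} (ζ p1 : ℝ) (g : (Fin k → Bool) × Bool → ℝ) :
    ∑ d, datumProb ζ p1 d * g d = ∑ v : Fin k → Bool, (∏ j, (if v j then ζ else 1 - ζ)) *
      (chooseCat1Prob p1 v * g (v, true) + (1 - chooseCat1Prob p1 v) * g (v, false)) := by
  rw [Fintype.sum_prod_type]
  refine Finset.sum_congr rfl fun v _ => ?_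
  simp [datumProb]
  ring

lemma sum_datumProb (k : ℕ) (ζ p1 : ℝ) : ∑ d : (Fin k → Bool) × Bool, datumProb ζ p1 d = 1 := by
  have h := sum_datumProb_mul (k := k) ζ p1 fun _ => 1
  simpa [sum_patternProb] using h

/-- The expected loss is increasing at `0`. -/
lemma expected_deriv_pos {k : ℕ} (hk : 2 ≤ k) {ζ p1 : ℝ} (hζ : ζ ∈ Set.Ioo (0 : ℝ) 1)
    (hF : p1 < (ζ - ζ ^ k) / (1 - ζ ^ k - (1 - ζ) ^ k)) :
    0 < ∑ d : (Fin k → Bool) × Bool,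
      datumProb ζ p1 d * ((catCount d.1 : ℝ) / k - if d.2 then 1 else 0) := by
  have hk0 : (k : ℝ) ≠ 0 := by
    have : k ≠ 0 := by omega
    exact_mod_cast this
  have h1 : ζ ^ k < ζ := pow_lt_self_of_lt_one₀ hζ.1 hζ.2 hk
  have h2 : (1 - ζ) ^ k < 1 - ζ :=
    pow_lt_self_of_lt_one₀ (sub_pos.2 hζ.2) (by linarith [hζ.1]) hk
  rw [lt_div_iff₀ (by linarith)] at hF
  have hv : ∀ v : Fin k → Bool, (∏ j, (if v j then ζ else 1 - ζ)) *
      (chooseCat1Prob p1 v * ((catCount v : ℝ) / k - 1) +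
        (1 - chooseCat1Prob p1 v) * ((catCount v : ℝ) / k - 0)) =
      (∏ j, (if v j then ζ else 1 - ζ)) * (catCount v : ℝ) / k -
        (∏ j, (if v j then ζ else 1 - ζ)) * chooseCat1Prob p1 v := by
    intro v
    ring
  rw [sum_datumProb_mul]
  simp only [if_true, Bool.false_eq_true, if_false, hv, Finset.sum_sub_distrib]
  rw [← Finset.sum_div, sum_patternProb_mul_catCount,
    sum_patternProb_mul_chooseCat1Prob (by omega), mul_div_cancel_left₀ _ hk0]
  linarith

lemma datumProb_mul_datumLoss_nonneg {k : ℕ} (hk : 0 < k) {ζ p1 : ℝ}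
    (hζ : ζ ∈ Set.Ioo (0 : ℝ) 1) (hp1 : p1 ∈ Set.Ioo (0 : ℝ) 1) (d : (Fin k → Bool) × Bool)
    {x : ℝ} (hx : x ≤ 0) :
    0 ≤ datumProb ζ p1 d * datumLoss d x := by
  by_cases hd : ∀ j, d.1 j = true
  · have hc : catCount d.1 = k := by simp [catCount, hd]
    by_cases h2 : d.2 = true
    · refine mul_nonneg (datumProb_nonneg hζ hp1 d) ?_
      have hk' : (k : ℝ) ≠ 0 := by exact_mod_cast hk.ne'
      rw [datumLoss, hc, if_pos h2, sub_self, add_zero, log_mul hk' (exp_pos _).ne', log_exp,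
        add_sub_cancel_right]
      exact log_natCast_nonneg k
    · simp [datumProb, chooseCat1Prob, hd, h2]
  · refine mul_nonneg (datumProb_nonneg hζ hp1 d) (sub_nonneg.2 ?_)
    have hc : catCount d.1 + 1 ≤ k := by
      have h : catCount d.1 < Fintype.card (Fin k) := by
        refine Finset.card_lt_univ_of_notMem (x := (not_forall.1 hd).choose) ?_
        simpa using (not_forall.1 hd).choose_spec
      rwa [Fintype.card_fin] at h
    have hc' : (catCount d.1 : ℝ) + 1 ≤ k := by exact_mod_cast hc
    have hlog : 0 ≤ log ((catCount d.1 : ℝ) * exp x + ((k : ℝ) - (catCount d.1 : ℝ))) :=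
      log_nonneg (by nlinarith [Nat.cast_nonneg (α := ℝ) (catCount d.1), exp_pos x])
    split_ifs <;> linarith

/-- The expected loss tends to infinity at `-∞`. -/
lemma exists_lt_expected_loss {k : ℕ} (hk : 2 ≤ k) {ζ p1 : ℝ}
    (hζ : ζ ∈ Set.Ioo (0 : ℝ) 1) (hp1 : p1 ∈ Set.Ioo (0 : ℝ) 1) (b C : ℝ) :
    ∃ a < b, C < ∑ d : (Fin k → Bool) × Bool, datumProb ζ p1 d * datumLoss d a := by
  have hk0 : 0 < k := by omega
  let i0 : Fin k := ⟨0, by omega⟩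
  let i1 : Fin k := ⟨1, by omega⟩
  have h01 : i1 ≠ i0 := by simp [i0, i1]
  let v : Fin k → Bool := fun j => decide (j = i0)
  have hcount : catCount v = 1 := by simp [catCount, v, Finset.filter_eq']
  have hw : 0 < datumProb ζ p1 (v, true) := by
    refine mul_pos (Finset.prod_pos fun j _ => ?_) ?_
    · split_ifs
      exacts [hζ.1, sub_pos.2 hζ.2]
    · have hne : ¬ ∀ j, v j = true := fun h => h01 (by simpa [v] using h i1)
      have hex : ∃ j, v j = true := ⟨i0, by simp [v]⟩
      simp only [if_true, chooseCat1Prob, if_neg hne, if_pos hex]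
      exact hp1.1
  set w := datumProb ζ p1 (v, true)
  obtain ⟨a, ha⟩ := (((eventually_lt_atBot b).and (eventually_le_atBot 0)).and
    (eventually_lt_atBot (-(C / w)))).exists
  obtain ⟨⟨hab, ha0⟩, haC⟩ := ha
  refine ⟨a, hab, ?_⟩
  have h1 := Finset.single_le_sum (f := fun d => datumProb ζ p1 d * datumLoss d a)
    (fun d _ => datumProb_mul_datumLoss_nonneg hk0 hζ hp1 d ha0) (Finset.mem_univ (v, true))
  refine lt_of_lt_of_le ?_ h1
  have hloss : -a ≤ datumLoss (v, true) a := by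
    have hk' : (2 : ℝ) ≤ k := by exact_mod_cast hk
    have : 0 ≤ log (exp a + ((k : ℝ) - 1)) := log_nonneg (by linarith [exp_pos a])
    simp [datumLoss, hcount]
    linarith
  have h2 : C / w < -a := by linarith
  rw [div_lt_iff₀ hw] at h2
  show C < w * datumLoss (v, true) a
  nlinarith

/-- There are three points `a < b < c < 0` such that the expected loss is larger at `a` and `c`
than at `b`. -/
lemma exists_expected_loss_valley {k : ℕ} (hk : 2 ≤ k) {ζ p1 : ℝ}
    (hζ : ζ ∈ Set.Ioo (0 : ℝ) 1) (hp1 : p1 ∈ Set.Ioo (0 : ℝ) 1)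
    (hF : p1 < (ζ - ζ ^ k) / (1 - ζ ^ k - (1 - ζ) ^ k)) :
    ∃ a b c : ℝ, a < b ∧ b < c ∧ c < 0 ∧
      0 < ∑ d : (Fin k → Bool) × Bool, datumProb ζ p1 d * (datumLoss d a - datumLoss d b) ∧
      0 < ∑ d : (Fin k → Bool) × Bool, datumProb ζ p1 d * (datumLoss d c - datumLoss d b) := by
  have hk0 : 0 < k := by omega
  let G : ℝ → ℝ := fun x => ∑ d : (Fin k → Bool) × Bool, datumProb ζ p1 d * datumLoss d x
  have hder : HasDerivAt G _ 0 := HasDerivAt.fun_sum fun d _ =>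
    (hasDerivAt_datumLoss_zero hk0 d).const_mul (datumProb ζ p1 d)
  have hcont : Continuous G := continuous_finsetSum _ fun d _ =>
    (continuous_datumLoss hk0 d).const_mul _
  obtain ⟨b, hb0, hb⟩ := exists_neg_lt_of_hasDerivAt_pos hder (expected_deriv_pos hk hζ hF)
  obtain ⟨c, hc, hc'⟩ := (((hcont.tendsto 0).mono_left
    (nhdsWithin_le_nhds (s := Set.Iio 0))).eventually_const_lt hb |>.and
      (Ioo_mem_nhdsLT hb0)).exists
  obtain ⟨a, hab, ha⟩ := exists_lt_expected_loss hk hζ hp1 b (G b)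
  refine ⟨a, b, c, hab, hc'.1, hc'.2, ?_, ?_⟩
  · simp only [mul_sub, Finset.sum_sub_distrib]
    exact sub_pos.2 ha
  · simp only [mul_sub, Finset.sum_sub_distrib]
    exact sub_pos.2 hc

/-- On a dataset whose empirical loss has a valley left of `c`, the reward loss has a minimizer,
and every minimizer has reward gap less than `c`. -/
lemma rewardLoss_minimizer_gap {k n : ℕ} (hk : 0 < k) (d : Fin n → (Fin k → Bool) × Bool)
    {a b c : ℝ} (hab : a < b) (hbc : b < c)
    (ha : 0 < ∑ i, (datumLoss (d i) a - datumLoss (d i) b))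
    (hc : 0 < ∑ i, (datumLoss (d i) c - datumLoss (d i) b)) :
    (∃ ψ, ∀ ψ', rewardLoss d ψ ≤ rewardLoss d ψ') ∧
      ∀ ψ : ℝ × ℝ, (∀ ψ', rewardLoss d ψ ≤ rewardLoss d ψ') → ψ.1 - ψ.2 < c := by
  rw [Finset.sum_sub_distrib, sub_pos] at ha hc
  obtain ⟨⟨x, hx⟩, hmin⟩ := exists_minimizer_of_support
    (f := fun x => ∑ i, datumLoss (d i) x)
    (continuous_finsetSum _ fun i _ => continuous_datumLoss hk (d i)) (fun y => by
      choose s hs using fun i => datumLoss_support hk (d i) y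
      refine ⟨∑ i, s i, fun x => ?_⟩
      rw [Finset.sum_mul, ← Finset.sum_add_distrib]
      exact Finset.sum_le_sum fun i _ => hs i x) hab hbc ha hc
  refine ⟨⟨(x, 0), fun ψ' => ?_⟩, fun ψ hψ => hmin _ fun y => ?_⟩
  · simpa [rewardLoss_eq hk] using hx (ψ'.1 - ψ'.2)
  · simpa [rewardLoss_eq hk] using hψ (y, 0)

/-- **Proposition 1 (RLPO failure).**  Under the dichotomy data model with query
size `k ≥ 3`, `ζ = P_π̄(M1) ∈ (0,1)`, `p*(1) ∈ (0,1)` and `p*(1) < F(ζ)` where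
`F(ζ) = (ζ - ζ^k)/(1 - ζ^k - (1-ζ)^k)`, if `ψ̂` is a minimizer of the reward
loss when one exists and `0` otherwise, and `θ̂` minimizes the policy loss for
reward `r_ψ̂`, then `P_{π_θ̂}(M1) → 0` and `P_{π_θ̂}(M2) → 1` in probability as
the dataset size `n → ∞`. -/
theorem rlpo_failure
    (k m1 m2 : ℕ) (hk : 3 ≤ k) (hm1 : 1 ≤ m1) (hm2 : 1 ≤ m2)
    (ζ p1 β : ℝ) (hζ : ζ ∈ Set.Ioo (0:ℝ) 1) (hp1 : p1 ∈ Set.Ioo (0:ℝ) 1) (hβ : 0 < β)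
    (hF : p1 < (ζ - ζ ^ k) / (1 - ζ ^ k - (1 - ζ) ^ k))
    (Ω : Type*) [MeasurableSpace Ω] (μ : Measure Ω) [IsProbabilityMeasure μ]
    -- the dataset of size `n`: `n` i.i.d. pattern-level data
    (D : (n : ℕ) → Fin n → Ω → (Fin k → Bool) × Bool)
    (hiid : ∀ n (dd : Fin n → (Fin k → Bool) × Bool),
      μ {ω | ∀ i, D n i ω = dd i} = ENNReal.ofReal (∏ i, datumProb ζ p1 (dd i)))
    (ψhat θhat : (n : ℕ) → Ω → ℝ × ℝ)
    -- `ψ̂` is a minimizer of the reward loss if one exists, and `0` otherwise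
    (hψmin : ∀ n ω,
      (∃ ψ, ∀ ψ', rewardLoss (fun i => D n i ω) ψ ≤ rewardLoss (fun i => D n i ω) ψ') →
      ∀ ψ', rewardLoss (fun i => D n i ω) (ψhat n ω) ≤ rewardLoss (fun i => D n i ω) ψ')
    (hψzero : ∀ n ω,
      (¬ ∃ ψ, ∀ ψ', rewardLoss (fun i => D n i ω) ψ ≤ rewardLoss (fun i => D n i ω) ψ') →
      ψhat n ω = 0)
    -- `θ̂` minimizes the policy loss for reward `r_ψ̂`
    (hθ : ∀ n ω θ', policyLoss m1 m2 ζ β n (ψhat n ω) (θhat n ω) ≤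
      policyLoss m1 m2 ζ β n (ψhat n ω) θ') :
    TendstoInMeasure μ (fun n ω => polM1 m1 m2 (θhat n ω)) atTop (fun _ => (0:ℝ)) ∧
    TendstoInMeasure μ (fun n ω => polM2 m1 m2 (θhat n ω)) atTop (fun _ => (1:ℝ)) := by
  have hk0 : 0 < k := by omega
  obtain ⟨a, b, c, hab, hbc, hc0, hGa, hGc⟩ :=
    exists_expected_loss_valley (by omega) hζ hp1 hF
  have hnonneg := datumProb_nonneg (k := k) hζ hp1
  have hA := tendsto_measure_sum_nonpos μ _ _ hnonneg (sum_datumProb k ζ p1) hGa D hiid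
  have hC := tendsto_measure_sum_nonpos μ _ _ hnonneg (sum_datumProb k ζ p1) hGc D hiid
  have hAC := hA.add hC
  rw [add_zero] at hAC
  have hbound : ∀ n ω, 0 < ∑ i, (datumLoss (D n i ω) a - datumLoss (D n i ω) b) →
      0 < ∑ i, (datumLoss (D n i ω) c - datumLoss (D n i ω) b) →
      n * -c * polM1 m1 m2 (θhat n ω) ≤ -(β * log (1 - ζ)) := by
    intro n ω ha hc
    obtain ⟨hex, hgap⟩ := rewardLoss_minimizer_gap hk0 (fun i => D n i ω) hab hbc ha hc
    have hlt := hgap _ (hψmin n ω hex)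
    refine le_trans ?_ (polM1_mul_le_of_minimizer hm1 hm2 hζ hβ n _ _ (hθ n ω))
    have := polM1_pos (m2 := m2) hm1 (θhat n ω)
    gcongr
    linarith
  have hsmall : ∀ ε > 0, Tendsto (fun n => μ {ω | ε ≤ polM1 m1 m2 (θhat n ω)}) atTop
      (nhds 0) := by
    intro ε hε
    refine tendsto_of_tendsto_of_tendsto_of_le_of_le' tendsto_const_nhds hAC
      (Eventually.of_forall fun _ => zero_le) ?_
    have hlarge : Tendsto (fun n : ℕ => (n : ℝ) * (-c * ε)) atTop atTop :=
      tendsto_natCast_atTop_atTop.atTop_mul_const (mul_pos (neg_pos.2 hc0) hε)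
    filter_upwards [hlarge.eventually_gt_atTop (-(β * log (1 - ζ)))] with n hn
    refine (measure_mono fun ω hω => ?_).trans (measure_union_le _ _)
    by_contra hbad
    simp only [Set.mem_union, Set.mem_ofPred_eq, not_or, not_le] at hbad
    have h1 := hbound n ω hbad.1 hbad.2
    have h2 : (n : ℝ) * -c * ε ≤ n * -c * polM1 m1 m2 (θhat n ω) :=
      mul_le_mul_of_nonneg_left hω (mul_nonneg n.cast_nonneg (neg_pos.2 hc0).le)
    linarith
  have hdist1 : ∀ n ω, dist (polM1 m1 m2 (θhat n ω)) 0 = polM1 m1 m2 (θhat n ω) := fun n ω => by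
    rw [Real.dist_0_eq_abs, abs_of_pos (polM1_pos hm1 _)]
  have hdist2 : ∀ n ω, dist (polM2 m1 m2 (θhat n ω)) 1 = polM1 m1 m2 (θhat n ω) := fun n ω => by
    rw [dist_comm, Real.dist_eq, ← polM1_add_polM2 (m2 := m2) hm1 (θhat n ω),
      add_sub_cancel_right, abs_of_pos (polM1_pos hm1 _)]
  constructor
  · rw [tendstoInMeasure_iff_dist]
    simpa only [hdist1] using hsmall
  · rw [tendstoInMeasure_iff_dist]
    simpa only [hdist2] using hsmall
end

section
/- (Lemma A.2, reward-minimizer gap.) Fix an integer k ≥ 2 and, for i = 1,…,n, counts a_i ∈ {0,…,k}, b_i = k - a_i, and chosen categories c_i ∈ {1,2} with a_i ≥ 1 whenever c_i = 1 and b_i ≥ 1 whenever c_i = 2 (a_i is the number of category-1 messages in the i-th query and c_i is the category of the chosen message). Let ρ_chosen = (1/n) Σ_i 1(c_i = 1) and ρ_data = (1/n) Σ_i a_i/k, and suppose ρ_data > ρ_chosen > 0 and that at least one i has c_i = 1 and b_i ≥ 1. Then the reward loss L(ψ) = -Σ_i [ ψ_{c_i} - ln( a_i e^{ψ1} + b_i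 e^{ψ2} ) ] over ψ = (ψ1, ψ2) ∈ ℝ² attains its minimum, and every minimizer ψ̂ satisfies ψ̂2 - ψ̂1 > (ρ_data - ρ_chosen)/(1 + ρ_data - ρ_chosen). -/
open Finset Real

/-- A weight at least `1` on `exp x` makes the log-partition at least `x`. -/
theorem le_log_weighted_exp_add {p q : ℝ} (hp : 1 ≤ p) (hq : 0 ≤ q) (x y : ℝ) :
    x ≤ log (p * exp x + q * exp y) := by
  have h1 : exp x ≤ p * exp x + q * exp y := by
    nlinarith [exp_pos x, mul_nonneg hq (exp_pos y).le]
  exact (le_log_iff_exp_le ((exp_pos x).trans_le h1)).2 h1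

theorem weighted_exp_add_pos {p K : ℝ} (hp : 0 ≤ p) (hpK : p ≤ K) (hK : 0 < K) (x y : ℝ) :
    0 < p * exp x + (K - p) * exp y := by
  rcases hp.eq_or_lt with rfl | h
  · simpa using mul_pos hK (exp_pos y)
  · exact add_pos_of_pos_of_nonneg (mul_pos h (exp_pos x))
      (mul_nonneg (sub_nonneg.2 hpK) (exp_pos y).le)

theorem exp_le_one_add_of_le_div {t d : ℝ} (hd : 0 < d) (h : t ≤ d / (1 + d)) :
    exp t ≤ 1 + d := by
  have h1 : (1 + d)⁻¹ ≤ exp (-t) := by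
    have h2 : (1 + d)⁻¹ = 1 - d / (1 + d) := by field_simp; ring
    linarith [add_one_le_exp (-t)]
  rw [exp_neg] at h1
  exact (inv_le_inv₀ (by linarith) (exp_pos t)).1 h1

/-- If the second category is favoured by a factor of at most `1 + d`, the softmax probability of
the first category falls short of its frequency by at most `d / 4`. -/
theorem div_sub_quarter_le_softmax {p K d x y : ℝ} (hp : 0 ≤ p) (hpK : p ≤ K) (hK : 0 < K)
    (hd : 0 ≤ d) (h : exp (y - x) ≤ 1 + d) :
    p / K - d / 4 ≤ p * exp x / (p * exp x + (K - p) * exp y) := by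
  have hx := exp_pos x
  have hy : exp y ≤ (1 + d) * exp x := by
    rwa [exp_sub, div_le_iff₀ hx] at h
  have hDpos := weighted_exp_add_pos hp hpK hK x y
  have hD : p * exp x + (K - p) * exp y ≤ (K + (K - p) * d) * exp x := by
    nlinarith [mul_le_mul_of_nonneg_left hy (sub_nonneg.2 hpK)]
  have hQ : 0 < K + (K - p) * d :=
    add_pos_of_pos_of_nonneg hK (mul_nonneg (sub_nonneg.2 hpK) hd)
  calc p / K - d / 4 ≤ p / (K + (K - p) * d) := by
        rw [le_div_iff₀ hQ]
        obtain ⟨r, rfl⟩ : ∃ r, p = r * K := ⟨p / K, by field_simp⟩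
        have hr0 : 0 ≤ r := nonneg_of_mul_nonneg_left hp hK
        have hr1 : r ≤ 1 := by nlinarith
        have hrK : r * K / K = r := by field_simp
        rw [hrK]
        have key : 0 ≤ K * (d * (1 / 4 - r * (1 - r)) + d * d * (1 - r) / 4) := by
          have h1 : 0 ≤ 1 / 4 - r * (1 - r) := by nlinarith [sq_nonneg (r - 1 / 2)]
          have h2 : 0 ≤ 1 - r := by linarith
          positivity
        linarith
    _ = p * exp x / ((K + (K - p) * d) * exp x) := by
        rw [mul_div_mul_right _ _ hx.ne']
    _ ≤ p * exp x / (p * exp x + (K - p) * exp y) := by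
        gcongr

/-- **Lemma A.2 (reward-minimizer gap).**  Fix an integer `k ≥ 2` and, for
`i = 1,…,n`, counts `a i ∈ {0,…,k}` of category-1 messages in the `i`-th query
(`b i = k - a i` category-2 messages) and chosen categories `c i` (`true` =
category 1), with `a i ≥ 1` whenever `c i = 1` and `b i ≥ 1` whenever `c i = 2`.
Let `ρ_chosen = (1/n) Σ_i 1(c i = 1)` and `ρ_data = (1/n) Σ_i (a i)/k`, and
suppose `ρ_data > ρ_chosen > 0` and that at least one `i` has `c i = 1` and
`b i ≥ 1`.  Then the reward loss
`L(ψ) = -Σ_i [ψ_{c_i} - ln(a_i e^{ψ1} + b_i e^{ψ2})]` over `ψ ∈ ℝ²` attains its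
minimum, and every minimizer `ψ̂` satisfies
`ψ̂2 - ψ̂1 > (ρ_data - ρ_chosen)/(1 + ρ_data - ρ_chosen)`. -/
theorem reward_minimizer_gap
    (k n : ℕ) (hk : 2 ≤ k)
    (a : Fin n → ℕ) (c : Fin n → Bool)
    (ha : ∀ i, a i ≤ k)
    (hc1 : ∀ i, c i = true → 1 ≤ a i)
    (hc2 : ∀ i, c i = false → a i < k)
    (ρchosen ρdata : ℝ)
    (hρchosen : ρchosen = (1 / (n : ℝ)) * ∑ i, (if c i then (1:ℝ) else 0))
    (hρdata : ρdata = (1 / (n : ℝ)) * ∑ i, (a i : ℝ) / k)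
    (hgt : ρdata > ρchosen) (hpos : ρchosen > 0)
    (hmix : ∃ i, c i = true ∧ a i < k)
    (L : ℝ × ℝ → ℝ)
    (hL : ∀ ψ, L ψ = -∑ i, ((if c i then ψ.1 else ψ.2) -
      log ((a i : ℝ) * exp ψ.1 + ((k : ℝ) - (a i : ℝ)) * exp ψ.2))) :
    (∃ ψ, ∀ ψ', L ψ ≤ L ψ') ∧
    (∀ ψhat : ℝ × ℝ, (∀ ψ', L ψhat ≤ L ψ') →
      ψhat.2 - ψhat.1 > (ρdata - ρchosen) / (1 + ρdata - ρchosen)) := by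
  have hK : (0 : ℝ) < k := by exact_mod_cast (by omega : 0 < k)
  have haK : ∀ i, (a i : ℝ) ≤ k := fun i => by exact_mod_cast ha i
  have ha0 : ∀ i, (0 : ℝ) ≤ a i := fun i => Nat.cast_nonneg _
  have hone_le_sub : ∀ i, a i < k → (1 : ℝ) ≤ k - a i := fun i h => by
    have : (a i : ℝ) + 1 ≤ k := by exact_mod_cast h
    linarith
  have hn : 0 < n := by
    obtain ⟨i, -⟩ := hmix
    exact i.pos
  have hnR : (0 : ℝ) < n := by exact_mod_cast hn
  have hchosen : ∑ i, (if c i then (1 : ℝ) else 0) = n * ρchosen := by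
    rw [hρchosen]; field_simp
  have hdata : ∑ i, (a i : ℝ) / k = n * ρdata := by
    rw [hρdata]; field_simp
  have hpart := fun i x y => weighted_exp_add_pos (ha0 i) (haK i) hK x y
  have hL' : ∀ ψ, L ψ = ∑ i, (log ((a i : ℝ) * exp ψ.1 + ((k : ℝ) - (a i : ℝ)) * exp ψ.2) -
      (if c i then ψ.1 else ψ.2)) := fun ψ => by
    rw [hL, ← Finset.sum_neg_distrib]
    exact Finset.sum_congr rfl fun i _ => by ring
  refine ⟨?_, ?_⟩
  · have hterm : ∀ (ψ : ℝ × ℝ) i, 0 ≤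
        log ((a i : ℝ) * exp ψ.1 + ((k : ℝ) - (a i : ℝ)) * exp ψ.2) -
          (if c i then ψ.1 else ψ.2) := fun ψ i => by
      cases hci : c i
      · have := le_log_weighted_exp_add (hone_le_sub i (hc2 i hci)) (ha0 i) ψ.2 ψ.1
        rw [add_comm] at this
        simpa using this
      · have := le_log_weighted_exp_add (p := a i) (by exact_mod_cast hc1 i hci)
          (sub_nonneg.2 (haK i)) ψ.1 ψ.2
        simpa using this
    have hterm_le : ∀ ψ i, log ((a i : ℝ) * exp ψ.1 + ((k : ℝ) - (a i : ℝ)) * exp ψ.2) -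
          (if c i then ψ.1 else ψ.2) ≤ L ψ := fun ψ i => by
      rw [hL']
      exact Finset.single_le_sum (fun j _ => hterm ψ j) (Finset.mem_univ i)
    obtain ⟨j, hcj, haj⟩ : ∃ j, c j = false ∧ 1 ≤ a j := by
      by_contra! hcon
      have hsum : ∑ i, (a i : ℝ) / k ≤ ∑ i, (if c i then (1 : ℝ) else 0) := by
        refine Finset.sum_le_sum fun i _ => ?_
        cases hci : c i
        · have : a i = 0 := by have := hcon i hci; omega
          simp [this]
        · simpa using div_le_one_of_le₀ (haK i) hK.le
      rw [hchosen, hdata] at hsum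
      exact absurd (le_of_mul_le_mul_left hsum hnR) (not_le.2 hgt)
    have habs : ∀ t, ‖t‖ ≤ L (0, t) := fun t => by
      obtain ⟨i, hci, hai⟩ := hmix
      rw [Real.norm_eq_abs, abs_le']
      constructor
      · have h1 := le_log_weighted_exp_add (hone_le_sub i hai) (ha0 i) t 0
        have h2 := hterm_le (0, t) i
        rw [add_comm] at h1
        simp only [hci, if_true] at h2
        linarith
      · have h1 := le_log_weighted_exp_add (p := a j) (by exact_mod_cast haj)
          (sub_nonneg.2 (haK j)) 0 t
        have h2 := hterm_le (0, t) j
        simp only [hcj, Bool.false_eq_true, if_false] at h2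
        linarith
    have hcont : Continuous fun t => L (0, t) := by
      simp only [hL']
      refine continuous_finsetSum _ fun i _ => Continuous.sub ?_ ?_
      · exact Continuous.log (by fun_prop) fun t => (hpart i 0 t).ne'
      · cases c i
        exacts [continuous_id, continuous_const]
    obtain ⟨t, ht⟩ := hcont.exists_forall_le
      (Filter.tendsto_atTop_mono habs tendsto_norm_cocompact_atTop)
    refine ⟨(0, t), fun ψ' => (ht (ψ'.2 - ψ'.1)).trans_eq ?_⟩
    simp only [hL']
    refine Finset.sum_congr rfl fun i _ => ?_
    have hfactor : (a i : ℝ) * exp ψ'.1 + ((k : ℝ) - a i) * exp ψ'.2 =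
        exp ψ'.1 * ((a i : ℝ) * exp 0 + ((k : ℝ) - a i) * exp (ψ'.2 - ψ'.1)) := by
      rw [exp_sub, exp_zero]; field_simp
    rw [hfactor, log_mul (exp_pos _).ne' (hpart i _ _).ne', log_exp]
    split_ifs <;> ring
  · rintro ⟨x, y⟩ hmin
    by_contra! hle
    have hd : 0 < ρdata - ρchosen := sub_pos.2 hgt
    rw [add_sub_assoc] at hle
    have hexp := exp_le_one_add_of_le_div hd hle
    have hderiv : HasDerivAt (fun u => L (u, y))
        (∑ i, ((a i : ℝ) * exp x / ((a i : ℝ) * exp x + ((k : ℝ) - a i) * exp y) -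
          (if c i then (1 : ℝ) else 0))) x := by
      simp only [hL']
      refine HasDerivAt.fun_sum fun i _ => HasDerivAt.sub ?_ ?_
      · exact (((Real.hasDerivAt_exp x).const_mul _).add_const _).log (hpart i x y).ne'
      · split_ifs
        · exact hasDerivAt_id x
        · exact hasDerivAt_const x y
    have hzero := IsLocalMin.hasDerivAt_eq_zero
      (Filter.Eventually.of_forall fun u => hmin (u, y)) hderiv
    have hsum := Finset.sum_le_sum fun i (_ : i ∈ Finset.univ) =>
      div_sub_quarter_le_softmax (ha0 i) (haK i) hK hd.le hexp
    rw [Finset.sum_sub_distrib, hchosen] at hzero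
    rw [Finset.sum_sub_distrib, hdata] at hsum
    simp only [Finset.sum_const, Finset.card_univ, Fintype.card_fin, nsmul_eq_mul] at hsum
    nlinarith [mul_pos hnR hd]
end

section
/- (Lemma A.10, deterministic SLiC failure.) Fix k = 2 and, for i = 1,…,n, counts a_i ∈ {0,1,2}, b_i = 2 - a_i, and chosen categories c_i ∈ {1,2} with a_i ≥ 1 whenever c_i = 1 and b_i ≥ 1 whenever c_i = 2. Let I = {i : a_i = 1}, I1 = {i ∈ I : c_i = 1}, I2 = {i ∈ I : c_i = 2}. Fix δ > 0, β > 0, and p1, p2 > 0 with p1 + p2 = 1, and for q ∈ (0,1) and m > 0 define L(q, m) = Σ_{i∈I1} max(0, ln(q/(m(1-q))) + δ) + Σ_{i∈I2} max(0, ln(m(1-q)/q) + δ) + |{i : a_i ∈ {0,2}}|·δ + β[ (1-q) ln((1-q)/p1) + q ln(q/p2) ]. If |I1| > 1 and |I2| > max{1+β, 2β ln(p2/p1)}, then for each m > 0 the function L(·, m) attains a minimum on (0,1), and any choice of minimizers q_m satisfies q_m → 1 as m → ∞. -/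
open Finset Real Filter

/-- Kullback-Leibler divergence of the distribution `(1 - q, q)` from `(p1, p2)`. -/
noncomputable def binaryKL (p1 p2 q : ℝ) : ℝ :=
  (1 - q) * Real.log ((1 - q) / p1) + q * Real.log (q / p2)

theorem binaryKL_eq {p1 p2 q : ℝ} (hp1 : 0 < p1) (hp2 : 0 < p2) (hq : q ∈ Set.Ioo (0 : ℝ) 1) :
    binaryKL p1 p2 q =
      -Real.binEntropy q - (1 - q) * Real.log p1 - q * Real.log p2 := by
  have h0 : q ≠ 0 := hq.1.ne'
  have h1 : 1 - q ≠ 0 := (sub_pos.2 hq.2).ne'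
  rw [binaryKL, Real.log_div h1 hp1.ne', Real.log_div h0 hp2.ne', Real.binEntropy,
    Real.log_inv, Real.log_inv]
  ring

theorem abs_binaryKL_le {p1 p2 q : ℝ} (hp1 : 0 < p1) (hp2 : 0 < p2)
    (hq : q ∈ Set.Ioo (0 : ℝ) 1) :
    |binaryKL p1 p2 q| ≤ Real.log 2 + |Real.log p1| + |Real.log p2| := by
  obtain ⟨h0, h1⟩ := hq
  have hE0 : 0 ≤ Real.binEntropy q := Real.binEntropy_nonneg h0.le h1.le
  have hE1 : Real.binEntropy q ≤ Real.log 2 := Real.binEntropy_le_log_two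
  have hA : |(1 - q) * Real.log p1| ≤ |Real.log p1| := by
    rw [abs_mul, abs_of_pos (sub_pos.2 h1)]
    exact mul_le_of_le_one_left (abs_nonneg _) (by linarith)
  have hB : |q * Real.log p2| ≤ |Real.log p2| := by
    rw [abs_mul, abs_of_pos h0]
    exact mul_le_of_le_one_left (abs_nonneg _) h1.le
  rw [binaryKL_eq hp1 hp2 ⟨h0, h1⟩]
  rw [abs_le] at hA hB ⊢
  constructor <;> linarith [hA.1, hA.2, hB.1, hB.2]

theorem continuous_binaryKL_sigmoid {p1 p2 : ℝ} (hp1 : 0 < p1) (hp2 : 0 < p2) :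
    Continuous fun s => binaryKL p1 p2 (Real.sigmoid s) := by
  have h : (fun s => binaryKL p1 p2 (Real.sigmoid s)) = fun s =>
      -Real.binEntropy (Real.sigmoid s) - (1 - Real.sigmoid s) * Real.log p1
        - Real.sigmoid s * Real.log p2 :=
    funext fun s => binaryKL_eq hp1 hp2 ⟨Real.sigmoid_pos s, Real.sigmoid_lt_one s⟩
  rw [h]
  have hs : Continuous Real.sigmoid := continuous_sigmoid
  have hE := Real.binEntropy_continuous.comp hs
  exact (hE.neg.sub ((continuous_const.sub hs).mul continuous_const)).sub
    (hs.mul continuous_const)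

/-- The log-odds of `q`, the inverse of the sigmoid function. -/
noncomputable def logOdds (q : ℝ) : ℝ := Real.log (q / (1 - q))

theorem sigmoid_logOdds {q : ℝ} (hq : q ∈ Set.Ioo (0 : ℝ) 1) :
    Real.sigmoid (logOdds q) = q := by
  have h0 : 0 < q := hq.1
  have h1 : 0 < 1 - q := sub_pos.2 hq.2
  rw [Real.sigmoid_def, logOdds, Real.exp_neg, Real.exp_log (div_pos h0 h1)]
  field_simp
  ring

/-- The SLiC loss as a function of `t = log m` and the log-odds `s` of `q`. -/
noncomputable def slicLogOddsLoss (N1 N2 δ β p1 p2 C t s : ℝ) : ℝ :=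
  N1 * max 0 (s - t + δ) + N2 * max 0 (t - s + δ) + C + β * binaryKL p1 p2 (Real.sigmoid s)

theorem abs_sub_le_slicLogOddsLoss {N1 N2 δ β p1 p2 : ℝ} (hN1 : 1 ≤ N1) (hN2 : 1 ≤ N2)
    (hδ : 0 < δ) (hβ : 0 < β) (hp1 : 0 < p1) (hp2 : 0 < p2) (C t s : ℝ) :
    |s - t| + C - β * (Real.log 2 + |Real.log p1| + |Real.log p2|) ≤
      slicLogOddsLoss N1 N2 δ β p1 p2 C t s := by
  have hK := mul_le_mul_of_nonneg_left (neg_le_of_abs_le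
    (abs_binaryKL_le hp1 hp2 ⟨Real.sigmoid_pos s, Real.sigmoid_lt_one s⟩)) hβ.le
  have h1 := le_mul_of_one_le_left (le_max_left 0 (s - t + δ)) hN1
  have h2 := le_mul_of_one_le_left (le_max_left 0 (t - s + δ)) hN2
  have h3 := le_max_left 0 (s - t + δ)
  have h4 := le_max_left 0 (t - s + δ)
  have h5 := le_max_right 0 (s - t + δ)
  have h6 := le_max_right 0 (t - s + δ)
  unfold slicLogOddsLoss
  rcases abs_cases (s - t) with ⟨h, _⟩ | ⟨h, _⟩ <;> rw [h] <;> linarith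

theorem slicLogOddsLoss_self_le {δ β p1 p2 : ℝ} (hδ : 0 < δ) (hβ : 0 < β)
    (hp1 : 0 < p1) (hp2 : 0 < p2) (N1 N2 C t : ℝ) :
    slicLogOddsLoss N1 N2 δ β p1 p2 C t t ≤
      N1 * δ + N2 * δ + C + β * (Real.log 2 + |Real.log p1| + |Real.log p2|) := by
  have hK := mul_le_mul_of_nonneg_left (le_of_abs_le
    (abs_binaryKL_le hp1 hp2 ⟨Real.sigmoid_pos t, Real.sigmoid_lt_one t⟩)) hβ.le
  rw [slicLogOddsLoss, sub_self, zero_add, max_eq_right hδ.le]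
  linarith

theorem exists_forall_slicLogOddsLoss_le {N1 N2 δ β p1 p2 : ℝ} (hN1 : 1 ≤ N1) (hN2 : 1 ≤ N2)
    (hδ : 0 < δ) (hβ : 0 < β) (hp1 : 0 < p1) (hp2 : 0 < p2) (C t : ℝ) :
    ∃ s, ∀ s', slicLogOddsLoss N1 N2 δ β p1 p2 C t s ≤ slicLogOddsLoss N1 N2 δ β p1 p2 C t s' := by
  have hcont : Continuous (slicLogOddsLoss N1 N2 δ β p1 p2 C t) := by
    have hK := continuous_binaryKL_sigmoid hp1 hp2
    unfold slicLogOddsLoss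
    fun_prop
  refine hcont.exists_forall_le ?_
  refine tendsto_atTop_mono (f := fun s : ℝ => ‖s‖ +
    (-|t| + C - β * (Real.log 2 + |Real.log p1| + |Real.log p2|))) (fun s => ?_)
    (tendsto_atTop_add_const_right _ _ (tendsto_norm_cocompact_atTop (E := ℝ)))
  have h := abs_sub_le_slicLogOddsLoss hN1 hN2 hδ hβ hp1 hp2 C t s
  have h' := abs_sub_abs_le_abs_sub s t
  rw [Real.norm_eq_abs]
  linarith

/-- **Lemma A.10 (deterministic SLiC failure).**  Fix `k = 2` and, for
`i = 1,…,n`, counts `a i ∈ {0,1,2}` of category-1 messages (`b i = 2 - a i`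
category-2 messages) and chosen categories `c i` (`true` = category 1), with
`a i ≥ 1` whenever `c i = 1` and `b i ≥ 1` whenever `c i = 2`.  Let
`I = {i : a i = 1}`, `I1 = {i ∈ I : c i = 1}`, `I2 = {i ∈ I : c i = 2}`.  Fix
`δ > 0`, `β > 0` and `p1, p2 > 0` with `p1 + p2 = 1`, and for `q ∈ (0,1)`,
`m > 0` define the SLiC loss
`L(q, m) = Σ_{i∈I1} max(0, ln(q/(m(1-q))) + δ) + Σ_{i∈I2} max(0, ln(m(1-q)/q) + δ)
          + |{i : a i ∈ {0,2}}|·δ + β[(1-q) ln((1-q)/p1) + q ln(q/p2)]`.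
If `|I1| > 1` and `|I2| > max{1+β, 2β ln(p2/p1)}`, then for each `m > 0` the
function `L(·, m)` attains a minimum on `(0,1)`, and any choice of minimizers
`q_m` satisfies `q_m → 1` as `m → ∞`. -/
theorem deterministic_slic_failure
    (n : ℕ)
    (a : Fin n → ℕ) (c : Fin n → Bool)
    (ha : ∀ i, a i ≤ 2)
    (hc1 : ∀ i, c i = true → 1 ≤ a i)
    (hc2 : ∀ i, c i = false → a i < 2)
    (δ β p1 p2 : ℝ) (hδ : 0 < δ) (hβ : 0 < β)
    (hp1 : 0 < p1) (hp2 : 0 < p2) (hp : p1 + p2 = 1)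
    (hI1 : 1 < ((univ.filter fun i => a i = 1 ∧ c i = true).card : ℝ))
    (hI2 : max (1 + β) (2 * β * Real.log (p2 / p1)) <
      ((univ.filter fun i => a i = 1 ∧ c i = false).card : ℝ))
    (L : ℝ → ℝ → ℝ)
    (hL : ∀ q m, L q m =
      (∑ i ∈ univ.filter fun i => a i = 1 ∧ c i = true,
        max 0 (Real.log (q / (m * (1 - q))) + δ)) +
      (∑ i ∈ univ.filter fun i => a i = 1 ∧ c i = false,
        max 0 (Real.log ((m * (1 - q)) / q) + δ)) +
      ((univ.filter fun i => a i = 0 ∨ a i = 2).card : ℝ) * δ +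
      β * ((1 - q) * Real.log ((1 - q) / p1) + q * Real.log (q / p2))) :
    (∀ m > (0:ℝ), ∃ q ∈ Set.Ioo (0:ℝ) 1, ∀ q' ∈ Set.Ioo (0:ℝ) 1, L q m ≤ L q' m) ∧
    (∀ qm : ℝ → ℝ,
      (∀ m > (0:ℝ), qm m ∈ Set.Ioo (0:ℝ) 1 ∧ ∀ q' ∈ Set.Ioo (0:ℝ) 1, L (qm m) m ≤ L q' m) →
      Tendsto qm atTop (nhds 1)) := by
  have hN1 := hI1.le
  have hN2 : (1 : ℝ) ≤ ((univ.filter fun i => a i = 1 ∧ c i = false).card : ℝ) := by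
    linarith [le_max_left (1 + β) (2 * β * Real.log (p2 / p1))]
  set N1 : ℝ := ((univ.filter fun i => a i = 1 ∧ c i = true).card : ℝ) with hN1_def
  set N2 : ℝ := ((univ.filter fun i => a i = 1 ∧ c i = false).card : ℝ) with hN2_def
  set C : ℝ := ((univ.filter fun i => a i = 0 ∨ a i = 2).card : ℝ) * δ with hC_def
  have key : ∀ q ∈ Set.Ioo (0 : ℝ) 1, ∀ m > (0 : ℝ),
      L q m = slicLogOddsLoss N1 N2 δ β p1 p2 C (Real.log m) (logOdds q) := by
    intro q hq m hm
    have h0 : 0 < q := hq.1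
    have h1 : 0 < 1 - q := sub_pos.2 hq.2
    have e1 : Real.log (q / (m * (1 - q))) = logOdds q - Real.log m := by
      rw [logOdds, Real.log_div h0.ne' (mul_pos hm h1).ne', Real.log_mul hm.ne' h1.ne',
        Real.log_div h0.ne' h1.ne']
      ring
    have e2 : Real.log ((m * (1 - q)) / q) = Real.log m - logOdds q := by
      rw [logOdds, Real.log_div (mul_pos hm h1).ne' h0.ne', Real.log_mul hm.ne' h1.ne',
        Real.log_div h0.ne' h1.ne']
      ring
    rw [hL, e1, e2, sum_const, sum_const, nsmul_eq_mul, nsmul_eq_mul, slicLogOddsLoss,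
      sigmoid_logOdds hq, binaryKL]
  have key' : ∀ s, ∀ m > (0 : ℝ),
      L (Real.sigmoid s) m = slicLogOddsLoss N1 N2 δ β p1 p2 C (Real.log m) s := by
    intro s m hm
    have hs : Real.sigmoid s ∈ Set.Ioo (0 : ℝ) 1 := ⟨Real.sigmoid_pos s, Real.sigmoid_lt_one s⟩
    rw [key _ hs m hm, Real.sigmoid_injective (sigmoid_logOdds hs)]
  refine ⟨fun m hm => ?_, fun qm hqm => ?_⟩
  · obtain ⟨s, hs⟩ :=
      exists_forall_slicLogOddsLoss_le hN1 hN2 hδ hβ hp1 hp2 C (Real.log m)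
    refine ⟨Real.sigmoid s, ⟨Real.sigmoid_pos s, Real.sigmoid_lt_one s⟩, fun q' hq' => ?_⟩
    rw [key' s m hm, key q' hq' m hm]
    exact hs _
  · set B := Real.log 2 + |Real.log p1| + |Real.log p2| with hB_def
    have hlower : ∀ m > (0 : ℝ),
        Real.log m + -(N1 * δ + N2 * δ + 2 * (β * B)) ≤ logOdds (qm m) := by
      intro m hm
      obtain ⟨hq, hmin⟩ := hqm m hm
      have h := hmin (Real.sigmoid (Real.log m))
        ⟨Real.sigmoid_pos _, Real.sigmoid_lt_one _⟩
      rw [key _ hq m hm, key' _ m hm] at h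
      have hl := abs_sub_le_slicLogOddsLoss hN1 hN2 hδ hβ hp1 hp2 C (Real.log m)
        (logOdds (qm m))
      have hu := slicLogOddsLoss_self_le hδ hβ hp1 hp2 N1 N2 C (Real.log m)
      have := neg_abs_le (logOdds (qm m) - Real.log m)
      linarith
    have hodds : Tendsto (fun m => logOdds (qm m)) atTop atTop :=
      tendsto_atTop_mono' _ ((eventually_gt_atTop 0).mono hlower)
        (tendsto_atTop_add_const_right _ _ Real.tendsto_log_atTop)
    refine (Real.tendsto_sigmoid_atTop.comp hodds).congr' ?_
    filter_upwards [eventually_gt_atTop 0] with m hm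
    exact sigmoid_logOdds (hqm m hm).1
end
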